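/- Fix s > 0 and let 0 < t₁ < t₂. Then there is no constant C > 0 such that d_{t₁}(x,y) ≤ C · d_{t₂}(x,y) holds for all x, y ∈ ℝ⁺; equivalently, the ratio d_{t₁}(x,y)/d_{t₂}(x,y) over pairs of distinct points x, y ∈ ℝ⁺ is unbounded. -/

import Mathlib

open Real Set

/-- The mother Haar wavelet `h = χ_{[0,1/2)} - χ_{[1/2,1)}`. -/
noncomputable def motherHaar (x : ℝ) : ℝ :=
  if 0 ≤ x ∧ x < 1 / 2 then 1 else if 1 / 2 ≤ x ∧ x < 1 then -1 else 0

/-- The Haar wavelet `h^j_k(x) = 2^{j/2} h(2^j x - k)`, supported on `I^j_k`. -/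
noncomputable def haarFn (j : ℤ) (k : ℕ) (x : ℝ) : ℝ :=
  (2 : ℝ) ^ ((j : ℝ) / 2) * motherHaar ((2 : ℝ) ^ j * x - (k : ℝ))

/-- The fractional dyadic diffusion distance
`d_t(x,y) = (Σ_h e^{-2t|I(h)|^{-s}} |h(x) - h(y)|²)^{1/2}`. -/
noncomputable def dyadicDt (s t x y : ℝ) : ℝ :=
  Real.sqrt (∑' p : ℤ × ℕ,
    Real.exp (-2 * t * ((2 : ℝ) ^ (-p.1)) ^ (-s)) * (haarFn p.1 p.2 x - haarFn p.1 p.2 y) ^ 2)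

theorem two_zpow_neg_rpow_neg (s : ℝ) (j : ℤ) :
    ((2 : ℝ) ^ (-j)) ^ (-s) = ((2 : ℝ) ^ s) ^ j := by
  rw [← Real.rpow_intCast, ← Real.rpow_intCast, ← Real.rpow_mul (by norm_num),
    ← Real.rpow_mul (by norm_num)]
  congr 1
  push_cast
  ring

theorem motherHaar_sq_le_one (x : ℝ) : motherHaar x ^ 2 ≤ 1 := by
  unfold motherHaar
  split_ifs <;> norm_num

theorem haarFn_sq_le (j : ℤ) (k : ℕ) (x : ℝ) : haarFn j k x ^ 2 ≤ (2 : ℝ) ^ j := by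
  have h : ((2 : ℝ) ^ ((j : ℝ) / 2)) ^ 2 = (2 : ℝ) ^ j := by
    rw [← Real.rpow_natCast, ← Real.rpow_mul (by norm_num), ← Real.rpow_intCast]
    congr 1
    push_cast
    ring
  rw [haarFn, mul_pow, h]
  exact mul_le_of_le_one_right (by positivity) (motherHaar_sq_le_one _)

theorem haarFn_eq_zero_of_ne_floor {j : ℤ} {k : ℕ} {x : ℝ}
    (hk : k ≠ ⌊(2 : ℝ) ^ j * x⌋₊) : haarFn j k x = 0 := by
  have h : ¬ ((k : ℝ) ≤ (2 : ℝ) ^ j * x ∧ (2 : ℝ) ^ j * x < k + 1) := by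
    rintro ⟨h₁, h₂⟩
    exact hk ((Nat.floor_eq_iff (le_trans (Nat.cast_nonneg k) h₁)).2 ⟨h₁, h₂⟩).symm
  rw [haarFn, motherHaar, if_neg, if_neg, mul_zero]
  · rintro ⟨h₁, h₂⟩
    exact h ⟨by linarith, by linarith⟩
  · rintro ⟨h₁, h₂⟩
    exact h ⟨by linarith, by linarith⟩

theorem summable_two_pow_mul_exp_neg {r c : ℝ} (hr : 1 < r) (hc : 0 < c) :
    Summable fun n : ℕ => (2 : ℝ) ^ n * Real.exp (-(c * r ^ n)) := by
  obtain ⟨m, hm⟩ := pow_unbounded_of_one_lt 4 hr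
  have hr0 : 0 < r := by linarith
  refine Summable.of_nonneg_of_le (fun n => by positivity) (fun n => ?_)
    ((summable_geometric_of_lt_one (r := 1 / 2) (by norm_num) (by norm_num)).mul_left
      ((m.factorial : ℝ) / c ^ m))
  have h₁ : (c * r ^ n) ^ m / (m.factorial : ℝ) ≤ Real.exp (c * r ^ n) :=
    Real.pow_div_factorial_le_exp _ (by positivity) m
  have h₂ : (4 : ℝ) ^ n ≤ (r ^ n) ^ m := by
    rw [← pow_mul, mul_comm, pow_mul]
    gcongr
  have h₃ : c ^ m * 4 ^ n / (m.factorial : ℝ) ≤ Real.exp (c * r ^ n) := by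
    refine le_trans ?_ h₁
    rw [mul_pow]
    gcongr
  have h₄ : (4 : ℝ) ^ n = 2 ^ n * 2 ^ n := by
    rw [← mul_pow]
    norm_num
  rw [Real.exp_neg]
  calc (2 : ℝ) ^ n * (Real.exp (c * r ^ n))⁻¹
      ≤ 2 ^ n * (c ^ m * 4 ^ n / (m.factorial : ℝ))⁻¹ := by gcongr
    _ = (m.factorial : ℝ) / c ^ m * (1 / 2) ^ n := by
        rw [h₄, one_div, inv_pow]
        field_simp

theorem summable_two_zpow_mul_exp_neg {r c : ℝ} (hr : 1 < r) (hc : 0 < c) :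
    Summable fun j : ℤ => (2 : ℝ) ^ j * Real.exp (-(c * r ^ j)) := by
  refine Summable.of_nat_of_neg ?_ ?_
  · simpa using summable_two_pow_mul_exp_neg hr hc
  · have hr0 : 0 < r := by linarith
    refine Summable.of_nonneg_of_le (fun n => by positivity) (fun n => ?_)
      (summable_geometric_of_lt_one (r := 1 / 2) (by norm_num) (by norm_num))
    rw [zpow_neg, zpow_natCast, one_div, inv_pow]
    refine mul_le_of_le_one_right (by positivity) (Real.exp_le_one_iff.2 ?_)
    exact neg_nonpos.2 (by positivity)

theorem summable_exp_mul_haarFn_sq {s t : ℝ} (hs : 0 < s) (ht : 0 < t) (x : ℝ) :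
    Summable fun p : ℤ × ℕ =>
      Real.exp (-2 * t * ((2 : ℝ) ^ (-p.1)) ^ (-s)) * haarFn p.1 p.2 x ^ 2 := by
  have hi : Function.Injective fun j : ℤ => (j, ⌊(2 : ℝ) ^ j * x⌋₊) :=
    fun a b h => congrArg Prod.fst h
  rw [← hi.summable_iff]
  · refine Summable.of_nonneg_of_le (fun j => by simp only [Function.comp]; positivity)
      (fun j => ?_)
      (summable_two_zpow_mul_exp_neg (r := (2 : ℝ) ^ s) (c := 2 * t)
        (Real.one_lt_rpow (by norm_num) hs) (by positivity))
    simp only [Function.comp, two_zpow_neg_rpow_neg]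
    rw [mul_comm, show -2 * t * ((2 : ℝ) ^ s) ^ j = -(2 * t * ((2 : ℝ) ^ s) ^ j) by ring]
    exact mul_le_mul_of_nonneg_right (haarFn_sq_le _ _ _) (Real.exp_pos _).le
  · rintro ⟨j, k⟩ hjk
    have hk : k ≠ ⌊(2 : ℝ) ^ j * x⌋₊ := fun h => hjk ⟨j, by rw [h]⟩
    simp [haarFn_eq_zero_of_ne_floor hk]

theorem summable_dyadicDt {s t : ℝ} (hs : 0 < s) (ht : 0 < t) (x y : ℝ) :
    Summable fun p : ℤ × ℕ =>
      Real.exp (-2 * t * ((2 : ℝ) ^ (-p.1)) ^ (-s)) *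
        (haarFn p.1 p.2 x - haarFn p.1 p.2 y) ^ 2 := by
  refine Summable.of_nonneg_of_le (fun p => by positivity) (fun p => ?_)
    (((summable_exp_mul_haarFn_sq hs ht x).add (summable_exp_mul_haarFn_sq hs ht y)).mul_left 2)
  rw [← mul_add, mul_left_comm]
  refine mul_le_mul_of_nonneg_left ?_ (Real.exp_pos _).le
  nlinarith [sq_nonneg (haarFn p.1 p.2 x + haarFn p.1 p.2 y)]

theorem haarFn_zero_eq_of_lt {j : ℤ} {n : ℕ} (h : j < n) (k : ℕ) :
    haarFn j k 0 = haarFn j k ((2 : ℝ) ^ (-((n : ℤ) + 1))) := by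
  have hu : (2 : ℝ) ^ j * (2 : ℝ) ^ (-((n : ℤ) + 1)) < 1 / 2 := by
    rw [← zpow_add₀ (by norm_num), show (1 / 2 : ℝ) = 2 ^ (-1 : ℤ) by norm_num]
    exact zpow_lt_zpow_right₀ (by norm_num) (by omega)
  have hu0 : 0 < (2 : ℝ) ^ j * (2 : ℝ) ^ (-((n : ℤ) + 1)) := by positivity
  unfold haarFn
  generalize (2 : ℝ) ^ j * (2 : ℝ) ^ (-((n : ℤ) + 1)) = u at hu hu0
  congr 1
  rcases Nat.eq_zero_or_pos k with rfl | hk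
  · simp only [motherHaar, mul_zero, Nat.cast_zero, sub_zero]
    rw [if_pos (by norm_num), if_pos ⟨hu0.le, hu⟩]
  · have hk1 : (1 : ℝ) ≤ k := by exact_mod_cast hk
    unfold motherHaar
    rw [if_neg, if_neg, if_neg, if_neg] <;> rintro ⟨h₁, h₂⟩ <;> linarith

theorem haarFn_zero_ne (n : ℕ) :
    haarFn n 0 0 ≠ haarFn n 0 ((2 : ℝ) ^ (-((n : ℤ) + 1))) := by
  have hu : (2 : ℝ) ^ (n : ℤ) * (2 : ℝ) ^ (-((n : ℤ) + 1)) = 1 / 2 := by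
    rw [← zpow_add₀ (by norm_num), show (n : ℤ) + -((n : ℤ) + 1) = -1 by ring]
    norm_num
  have hc : (0 : ℝ) < (2 : ℝ) ^ (((n : ℤ) : ℝ) / 2) := by positivity
  unfold haarFn
  rw [hu]
  norm_num [motherHaar]
  norm_num at hc
  linarith

theorem dyadicDt_pos {s t : ℝ} (hs : 0 < s) (ht : 0 < t) (n : ℕ) :
    0 < dyadicDt s t 0 ((2 : ℝ) ^ (-((n : ℤ) + 1))) := by
  refine Real.sqrt_pos.2
    ((summable_dyadicDt hs ht _ _).tsum_pos (fun p => by positivity) ((n : ℤ), 0) ?_)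
  exact mul_pos (Real.exp_pos _) (sq_pos_of_ne_zero (sub_ne_zero.2 (haarFn_zero_ne n)))

theorem exp_mul_dyadicDt_le {s t₁ t₂ : ℝ} (hs : 0 < s) (ht₁ : 0 < t₁) (ht₁₂ : t₁ < t₂)
    (n : ℕ) :
    Real.exp ((t₂ - t₁) * ((2 : ℝ) ^ s) ^ n) *
        dyadicDt s t₂ 0 ((2 : ℝ) ^ (-((n : ℤ) + 1))) ≤
      dyadicDt s t₁ 0 ((2 : ℝ) ^ (-((n : ℤ) + 1))) := by
  unfold dyadicDt
  refine Real.le_sqrt_of_sq_le ?_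
  rw [mul_pow, Real.sq_sqrt (tsum_nonneg fun p => by positivity), ← Real.exp_nat_mul,
    ← tsum_mul_left]
  refine Summable.tsum_le_tsum (fun p => ?_)
    ((summable_dyadicDt hs (ht₁.trans ht₁₂) _ _).mul_left _) (summable_dyadicDt hs ht₁ _ _)
  rcases lt_or_ge p.1 (n : ℤ) with h | h
  · simp [haarFn_zero_eq_of_lt h]
  · rw [← mul_assoc, ← Real.exp_add, two_zpow_neg_rpow_neg]
    refine mul_le_mul_of_nonneg_right (Real.exp_le_exp.2 ?_) (sq_nonneg _)
    have hle : ((2 : ℝ) ^ s) ^ n ≤ ((2 : ℝ) ^ s) ^ p.1 := by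
      rw [← zpow_natCast]
      exact zpow_le_zpow_right₀ (Real.one_lt_rpow (by norm_num) hs).le h
    push_cast
    nlinarith [mul_le_mul_of_nonneg_left hle (sub_pos.2 ht₁₂).le]

/-- For `0 < t₁ < t₂` there is no constant `C > 0` with `d_{t₁} ≤ C d_{t₂}` on `ℝ⁺`;
equivalently, the ratio `d_{t₁}(x,y)/d_{t₂}(x,y)` over distinct `x, y ∈ ℝ⁺` is unbounded. -/
theorem dyadicDt_no_reverse_comparison (s t₁ t₂ : ℝ) (hs : 0 < s) (ht₁ : 0 < t₁)
    (ht₁₂ : t₁ < t₂) :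
    (¬ ∃ C : ℝ, 0 < C ∧ ∀ x ∈ Set.Ici (0 : ℝ), ∀ y ∈ Set.Ici (0 : ℝ),
      dyadicDt s t₁ x y ≤ C * dyadicDt s t₂ x y) ∧
    (∀ M : ℝ, ∃ x ∈ Set.Ici (0 : ℝ), ∃ y ∈ Set.Ici (0 : ℝ), x ≠ y ∧
      M < dyadicDt s t₁ x y / dyadicDt s t₂ x y) := by
  have key : ∀ M : ℝ, ∃ x ∈ Set.Ici (0 : ℝ), ∃ y ∈ Set.Ici (0 : ℝ), x ≠ y ∧
      M < dyadicDt s t₁ x y / dyadicDt s t₂ x y := by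
    intro M
    obtain ⟨n, hn⟩ := pow_unbounded_of_one_lt (M / (t₂ - t₁))
      (Real.one_lt_rpow (by norm_num : (1 : ℝ) < 2) hs)
    rw [div_lt_iff₀' (sub_pos.2 ht₁₂)] at hn
    have hy : (0 : ℝ) < (2 : ℝ) ^ (-((n : ℤ) + 1)) := by positivity
    refine ⟨0, Set.self_mem_Ici, _, hy.le, hy.ne, ?_⟩
    refine lt_of_lt_of_le ?_ ((le_div_iff₀ (dyadicDt_pos hs (ht₁.trans ht₁₂) n)).2
      (exp_mul_dyadicDt_le hs ht₁ ht₁₂ n))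
    linarith [Real.add_one_le_exp ((t₂ - t₁) * ((2 : ℝ) ^ s) ^ n)]
  refine ⟨?_, key⟩
  rintro ⟨C, hC, h⟩
  obtain ⟨x, hx, y, hy, -, hlt⟩ := key C
  exact hlt.not_ge (div_le_of_le_mul₀ (Real.sqrt_nonneg _) hC.le (h x hx y hy))
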